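/- arXiv:2601.07222 — 4 statements merged into one kernel-verified Lean document; each statement's English description precedes it below -/
import Mathlib

section
/- Let 1 ≤ d₁ < d₂ be integers. Then the number of intersecting pairs (Q, R) ∈ 𝒬_{d₁} × ℛ_{d₂} with both Q and R primitive equals (q−1)²·(q+1)·q^{2d₁+2d₂−3}. (This is the finite-field point count of the space of based maps ℙ¹ → Fl₃ of degree (d₁,d₂), i.e. the counting form of the paper's main theorem for n = 2.) -/
open Polynomial

/-- `Qset F d`: triples `(q₀, q₁, q₂)` of polynomials over `F` with `q₀` monic of degree `d`
and `q₁, q₂` of degree `< d`. -/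
def Qset (F : Type*) [Field F] (d : ℕ) : Set (F[X] × F[X] × F[X]) :=
  {t | t.1.Monic ∧ t.1.natDegree = d ∧
    t.2.1.degree < (d : WithBot ℕ) ∧ t.2.2.degree < (d : WithBot ℕ)}

/-- `Rset F d`: triples `(r₀, r₁, r₂)` of polynomials over `F` with `r₂` monic of degree `d`
and `r₀, r₁` of degree `< d`. -/
def Rset (F : Type*) [Field F] (d : ℕ) : Set (F[X] × F[X] × F[X]) :=
  {t | t.2.2.Monic ∧ t.2.2.natDegree = d ∧
    t.1.degree < (d : WithBot ℕ) ∧ t.2.1.degree < (d : WithBot ℕ)}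

/-- A triple is primitive if every common divisor of its three entries is a unit. -/
def Primitive {F : Type*} [Field F] (t : F[X] × F[X] × F[X]) : Prop :=
  ∀ g : F[X], g ∣ t.1 → g ∣ t.2.1 → g ∣ t.2.2 → IsUnit g

/-- A pair `(Q, R)` is intersecting if `q₀r₀ + q₁r₁ + q₂r₂ = 0`. -/
def Intersecting {F : Type*} [Field F] (Q R : F[X] × F[X] × F[X]) : Prop :=
  Q.1 * R.1 + Q.2.1 * R.2.1 + Q.2.2 * R.2.2 = 0


namespace Flag

variable {F : Type*} [Field F]

/-- Scaling of a triple. -/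
noncomputable def sm (g : F[X]) (t : F[X] × F[X] × F[X]) : F[X] × F[X] × F[X] :=
  (g * t.1, g * t.2.1, g * t.2.2)

lemma bezout_gen (t : F[X] × F[X] × F[X]) :
    ∃ d a b c : F[X], d ∣ t.1 ∧ d ∣ t.2.1 ∧ d ∣ t.2.2 ∧ a * t.1 + b * t.2.1 + c * t.2.2 = d := by
  classical
  set g := EuclideanDomain.gcd t.2.1 t.2.2 with hg
  refine ⟨EuclideanDomain.gcd t.1 g, EuclideanDomain.gcdA t.1 g,
    EuclideanDomain.gcdB t.1 g * EuclideanDomain.gcdA t.2.1 t.2.2,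
    EuclideanDomain.gcdB t.1 g * EuclideanDomain.gcdB t.2.1 t.2.2,
    EuclideanDomain.gcd_dvd_left _ _,
    (EuclideanDomain.gcd_dvd_right _ _).trans (EuclideanDomain.gcd_dvd_left _ _),
    (EuclideanDomain.gcd_dvd_right _ _).trans (EuclideanDomain.gcd_dvd_right _ _), ?_⟩
  have h1 := EuclideanDomain.gcd_eq_gcd_ab t.1 g
  have h2 := EuclideanDomain.gcd_eq_gcd_ab t.2.1 t.2.2
  rw [← hg] at h2
  rw [h1]
  linear_combination (-EuclideanDomain.gcdB t.1 g) * h2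

lemma prim_iff (t : F[X] × F[X] × F[X]) :
    Primitive t ↔ ∃ a b c : F[X], a * t.1 + b * t.2.1 + c * t.2.2 = 1 := by
  constructor
  · intro h
    obtain ⟨d, a, b, c, h1, h2, h3, h4⟩ := bezout_gen t
    obtain ⟨u, hu⟩ := h d h1 h2 h3
    refine ⟨↑u⁻¹ * a, ↑u⁻¹ * b, ↑u⁻¹ * c, ?_⟩
    have : (↑u⁻¹ : F[X]) * d = 1 := by rw [← hu]; simp
    rw [← this, ← h4]; ring
  · rintro ⟨a, b, c, h⟩ g h1 h2 h3
    apply isUnit_of_dvd_one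
    rw [← h]
    exact dvd_add (dvd_add (h1.mul_left _) (h2.mul_left _)) (h3.mul_left _)

lemma sm_dvd {g g' : F[X]} {t t' : F[X] × F[X] × F[X]} (ht : Primitive t)
    (h : sm g t = sm g' t') : g' ∣ g := by
  obtain ⟨a, b, c, habc⟩ := (prim_iff t).1 ht
  simp only [sm, Prod.mk.injEq] at h
  obtain ⟨h1, h2, h3⟩ := h
  refine ⟨a * t'.1 + b * t'.2.1 + c * t'.2.2, ?_⟩
  linear_combination (-g) * habc + a * h1 + b * h2 + c * h3

lemma sm_inj {g g' : F[X]} {t t' : F[X] × F[X] × F[X]} (hg : g.Monic) (hg' : g'.Monic)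
    (ht : Primitive t) (ht' : Primitive t')
    (h : sm g t = sm g' t') : g = g' ∧ t = t' := by
  have e : g = g' := eq_of_monic_of_associated hg hg'
    (associated_of_dvd_dvd (sm_dvd ht' h.symm) (sm_dvd ht h))
  refine ⟨e, ?_⟩
  subst e
  simp only [sm, Prod.mk.injEq, mul_eq_mul_left_iff, hg.ne_zero, or_false] at h
  exact Prod.ext h.1 (Prod.ext h.2.1 h.2.2)

lemma sm_surj (s : F[X] × F[X] × F[X]) (hs : s.1 ≠ 0) :
    ∃ g t, g.Monic ∧ Primitive t ∧ sm g t = s := by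
  obtain ⟨d, a, b, c, ⟨x, hx⟩, ⟨y, hy⟩, ⟨z, hz⟩, h4⟩ := bezout_gen s
  have hd : d ≠ 0 := by rintro rfl; simp at hx; exact hs hx
  have hl : d.leadingCoeff ≠ 0 := by simpa using hd
  have hC : C d.leadingCoeff⁻¹ * C d.leadingCoeff = (1 : F[X]) := by
    rw [← C_mul, inv_mul_cancel₀ hl, C_1]
  refine ⟨d * C d.leadingCoeff⁻¹, (C d.leadingCoeff * x, C d.leadingCoeff * y,
    C d.leadingCoeff * z), monic_mul_leadingCoeff_inv hd, ?_, ?_⟩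
  · rw [prim_iff]
    refine ⟨C d.leadingCoeff⁻¹ * a, C d.leadingCoeff⁻¹ * b, C d.leadingCoeff⁻¹ * c, ?_⟩
    apply mul_left_cancel₀ hd
    rw [hx, hy, hz] at h4
    simp only
    linear_combination (d * (a * x + b * y + c * z)) * hC + h4
  · simp only [sm]
    refine Prod.ext ?_ (Prod.ext ?_ ?_)
    · simp only; rw [hx]; linear_combination (d * x) * hC
    · simp only; rw [hy]; linear_combination (d * y) * hC
    · simp only; rw [hz]; linear_combination (d * z) * hC

lemma deg_aux {g p : F[X]} (hg : g.Monic) (e : ℕ) :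
    (g * p).degree < ((g.natDegree + e : ℕ) : WithBot ℕ) ↔ p.degree < (e : WithBot ℕ) := by
  by_cases hp : p = 0
  · subst hp; simp
  · rw [degree_eq_natDegree (mul_ne_zero hg.ne_zero hp), degree_eq_natDegree hp,
      natDegree_mul hg.ne_zero hp]
    norm_cast
    omega

lemma sm_mem_Qset {g : F[X]} (hg : g.Monic) (t : F[X] × F[X] × F[X]) (e : ℕ) :
    sm g t ∈ Qset F (g.natDegree + e) ↔ t ∈ Qset F e := by
  simp only [Qset, sm, Set.mem_ofPred_eq, deg_aux hg]
  constructor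
  · rintro ⟨h1, h2, h3⟩
    have := hg.of_mul_monic_left h1
    rw [hg.natDegree_mul this] at h2
    exact ⟨this, by omega, h3⟩
  · rintro ⟨h1, h2, h3⟩
    exact ⟨hg.mul h1, by rw [hg.natDegree_mul h1, h2], h3⟩

lemma mem_Qset_deg {g : F[X]} (hg : g.Monic) {t : F[X] × F[X] × F[X]} {e : ℕ}
    (h : sm g t ∈ Qset F e) : t.1.Monic ∧ g.natDegree + t.1.natDegree = e := by
  have := hg.of_mul_monic_left h.1
  have h2 := h.2.1
  simp only [sm] at h2
  rw [hg.natDegree_mul this] at h2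
  exact ⟨this, h2⟩

variable [Fintype F]

lemma card_degreeLT (d : ℕ) : Nat.card (degreeLT F d) = Fintype.card F ^ d := by
  rw [Nat.card_congr (degreeLTEquiv F d).toEquiv]
  simp

instance (d : ℕ) : Finite (degreeLT F d) := Finite.of_equiv _ (degreeLTEquiv F d).toEquiv.symm

/-- `Qset` is a cube of an affine space. -/
noncomputable def QsetEquiv (d : ℕ) :
    Qset F d ≃ degreeLT F d × degreeLT F d × degreeLT F d where
  toFun t := (⟨t.1.1 - X ^ d, by
      obtain ⟨h1, h2, -⟩ := t.2
      rw [mem_degreeLT]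
      have h3 : t.1.1.degree = d := by rw [degree_eq_natDegree h1.ne_zero, h2]
      rw [← h3]
      apply degree_sub_lt_left
      · rw [h3, degree_X_pow]
      · exact h1.ne_zero
      · rw [h1.leadingCoeff, leadingCoeff_X_pow]⟩,
    ⟨t.1.2.1, mem_degreeLT.2 t.2.2.2.1⟩, ⟨t.1.2.2, mem_degreeLT.2 t.2.2.2.2⟩)
  invFun p := ⟨(X ^ d + p.1.1, p.2.1.1, p.2.2.1), by
    have h := mem_degreeLT.1 p.1.2
    refine ⟨monic_X_pow_add h, ?_, mem_degreeLT.1 p.2.1.2, mem_degreeLT.1 p.2.2.2⟩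
    apply natDegree_eq_of_degree_eq_some
    simp only
    rw [degree_add_eq_left_of_degree_lt, degree_X_pow]
    rwa [degree_X_pow]⟩
  left_inv t := by simp
  right_inv p := by simp

lemma Qset_finite (d : ℕ) : (Qset F d).Finite := by
  have : Finite (Qset F d) := Finite.of_equiv _ (QsetEquiv d).symm
  exact Set.toFinite _

lemma Qset_ncard (d : ℕ) : (Qset F d).ncard = Fintype.card F ^ (3 * d) := by
  rw [← Nat.card_coe_set_eq, Nat.card_congr (QsetEquiv d), Nat.card_prod, Nat.card_prod,
    card_degreeLT]
  ring

lemma rec_count (K : Set (F[X] × F[X] × F[X]))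
    (hK : ∀ g : F[X], g ≠ 0 → ∀ t, sm g t ∈ K ↔ t ∈ K) (e : ℕ) :
    (Qset F (e + 1) ∩ K).ncard =
      ((Qset F (e + 1) ∩ K) ∩ {t | Primitive t}).ncard +
        Fintype.card F * (Qset F e ∩ K).ncard := by
  set A : Set (F[X] × (F[X] × F[X] × F[X])) :=
    {p | p.1.Monic ∧ Primitive p.2 ∧ sm p.1 p.2 ∈ Qset F e ∩ K} with hA
  have hA1 : (Qset F e ∩ K).ncard = A.ncard := by
    have : Qset F e ∩ K = (fun p : F[X] × (F[X] × F[X] × F[X]) => sm p.1 p.2) '' A := by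
      ext s
      constructor
      · intro hs
        obtain ⟨g, t, hg, ht, rfl⟩ := sm_surj s hs.1.1.ne_zero
        exact ⟨(g, t), ⟨hg, ht, hs⟩, rfl⟩
      · rintro ⟨p, hp, rfl⟩
        exact hp.2.2
    rw [this, Set.InjOn.ncard_image]
    intro p hp p' hp' h
    obtain ⟨h1, h2⟩ := sm_inj hp.1 hp'.1 hp.2.1 hp'.2.1 h
    exact Prod.ext h1 h2
  have hmon : ∀ (g : F[X]) (c : F), g.Monic →
      (X * g + C c).Monic ∧ (X * g + C c).natDegree = g.natDegree + 1 := by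
    intro g c hg
    have hd : (C c).degree < (X * g).degree := by
      refine degree_C_le.trans_lt ?_
      rw [degree_eq_natDegree (mul_ne_zero X_ne_zero hg.ne_zero),
        natDegree_X_mul hg.ne_zero]
      norm_cast; omega
    refine ⟨(monic_X.mul hg).add_of_left hd, ?_⟩
    rw [natDegree_add_C, natDegree_X_mul hg.ne_zero]
  have hA2 : ((Qset F (e + 1) ∩ K) \ {t | Primitive t}).ncard = Fintype.card F * A.ncard := by
    have : (Qset F (e + 1) ∩ K) \ {t | Primitive t} =
        (fun p : F × (F[X] × (F[X] × F[X] × F[X])) => sm (X * p.2.1 + C p.1) p.2.2) ''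
          ((Set.univ : Set F) ×ˢ A) := by
      ext s
      constructor
      · rintro ⟨hs, hp⟩
        obtain ⟨g, t, hg, ht, rfl⟩ := sm_surj s hs.1.1.ne_zero
        obtain ⟨m1, m2⟩ := mem_Qset_deg hg hs.1
        have hg1 : g.natDegree ≠ 0 := by
          intro h0
          rw [hg.natDegree_eq_zero] at h0
          subst h0
          apply hp
          simpa [sm] using ht
        have hX : X * g.divX + C (g.coeff 0) = g := X_mul_divX_add g
        have hdeg : g.divX.natDegree + 1 = g.natDegree := by
          rw [natDegree_divX_eq_natDegree_tsub_one]; omega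
        have hgm : g.divX.Monic := by
          rw [Monic, leadingCoeff, coeff_divX, hdeg]; exact hg
        refine ⟨(g.coeff 0, g.divX, t), ⟨trivial, hgm, ht, ?_, ?_⟩, ?_⟩
        · have : t ∈ Qset F t.1.natDegree := by
            rw [← sm_mem_Qset hg, m2]; exact hs.1
          have h := (sm_mem_Qset hgm t t.1.natDegree).2 this
          have h' : g.divX.natDegree + t.1.natDegree = e := by omega
          rwa [h'] at h
        · exact (hK _ hgm.ne_zero _).2 ((hK _ hg.ne_zero _).1 hs.2)
        · simp only [hX]
      · rintro ⟨⟨c, g, t⟩, ⟨-, hg, ht, hs⟩, rfl⟩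
        obtain ⟨hm, hd⟩ := hmon g c hg
        simp only at hg ht hs ⊢
        obtain ⟨m1, m2⟩ := mem_Qset_deg hg hs.1
        refine ⟨⟨?_, (hK _ hm.ne_zero _).2 ((hK _ hg.ne_zero _).1 hs.2)⟩, ?_⟩
        · have : t ∈ Qset F t.1.natDegree := by
            rw [← sm_mem_Qset hg, m2]; exact hs.1
          have h := (sm_mem_Qset hm t t.1.natDegree).2 this
          have h' : (X * g + C c).natDegree + t.1.natDegree = e + 1 := by omega
          rwa [h'] at h
        · intro hp
          have := hp (X * g + C c) (Dvd.intro _ rfl) (Dvd.intro _ rfl) (Dvd.intro _ rfl)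
          have := natDegree_eq_zero_of_isUnit this
          omega
    rw [this, Set.InjOn.ncard_image, Set.ncard_prod, Set.ncard_univ, Nat.card_eq_fintype_card]
    rintro ⟨c, g, t⟩ ⟨-, hg, ht, hs⟩ ⟨c', g', t'⟩ ⟨-, hg', ht', hs'⟩ h
    simp only at hg ht hs hg' ht' hs' h
    obtain ⟨h1, h2⟩ := sm_inj (hmon g c hg).1 (hmon g' c' hg').1 ht ht' h
    have e1 : c = c' := by simpa using congrArg (fun p => coeff p 0) h1
    subst e1
    have e2 : g = g' := by simpa [X_ne_zero] using h1
    rw [e2, h2]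
  rw [hA1, ← hA2]
  exact (Set.ncard_inter_add_ncard_sdiff_eq_ncard _ _ ((Qset_finite _).inter_of_left _)).symm

lemma primQ_count (d : ℕ) (hd : 1 ≤ d) :
    (Qset F d ∩ {t | Primitive t}).ncard + Fintype.card F ^ (3 * d - 2) =
      Fintype.card F ^ (3 * d) := by
  obtain ⟨e, rfl⟩ := Nat.exists_eq_add_of_le' hd
  have h := rec_count (F := F) Set.univ (by simp) e
  simp only [Set.inter_univ, Qset_ncard] at h
  rw [h, show 3 * (e + 1) - 2 = 3 * e + 1 by omega, pow_succ']

/-- The (reversed) orthogonal set of a triple. -/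
def Ker (Q : F[X] × F[X] × F[X]) : Set (F[X] × F[X] × F[X]) :=
  {t | Q.1 * t.2.2 + Q.2.1 * t.2.1 + Q.2.2 * t.1 = 0}

/-- The residue map. -/
noncomputable def phi (Q : F[X] × F[X] × F[X]) (d e : ℕ) (hQ : Q ∈ Qset F d) :
    (degreeLT F e × degreeLT F e) →+ degreeLT F d where
  toFun p := ⟨(Q.2.2 * p.1.1 + Q.2.1 * p.2.1) %ₘ Q.1, by
    rw [mem_degreeLT, ← hQ.2.1, ← degree_eq_natDegree hQ.1.ne_zero]
    exact degree_modByMonic_lt _ hQ.1⟩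
  map_zero' := by simp
  map_add' p p' := by
    ext1
    simp only [Prod.fst_add, Prod.snd_add, Submodule.coe_add, ← add_modByMonic]
    congr 1; ring

lemma phi_surj (Q : F[X] × F[X] × F[X]) (d e : ℕ) (hQ : Q ∈ Qset F d) (hp : Primitive Q)
    (hde : d ≤ e) : Function.Surjective (phi Q d e hQ) := by
  obtain ⟨a, b, c, h⟩ := (prim_iff Q).1 hp
  have hdeg : ∀ p : F[X], p %ₘ Q.1 ∈ degreeLT F e := by
    intro p
    rw [mem_degreeLT]
    refine (degree_modByMonic_lt p hQ.1).trans_le ?_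
    rw [degree_eq_natDegree hQ.1.ne_zero, hQ.2.1]
    exact_mod_cast hde
  rintro ⟨w, hw⟩
  refine ⟨(⟨_, hdeg (w * c)⟩, ⟨_, hdeg (w * b)⟩), ?_⟩
  ext1
  simp only [phi, AddMonoidHom.coe_mk, ZeroHom.coe_mk]
  have hw' : w %ₘ Q.1 = w := by
    rw [modByMonic_eq_self_iff hQ.1, degree_eq_natDegree hQ.1.ne_zero, hQ.2.1]
    exact mem_degreeLT.1 hw
  refine Eq.trans ?_ hw'
  apply modByMonic_eq_of_dvd_sub hQ.1
  have h1 := modByMonic_add_div (w * c) Q.1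
  have h2 := modByMonic_add_div (w * b) Q.1
  refine ⟨-(w * a) - Q.2.2 * (w * c /ₘ Q.1) - Q.2.1 * (w * b /ₘ Q.1), ?_⟩
  linear_combination w * h + Q.2.2 * h1 + Q.2.1 * h2

lemma fiber_card {G H : Type*} [AddGroup G] [AddGroup H] [Finite G] (f : G →+ H)
    (hf : Function.Surjective f) (y : H) :
    Nat.card {x // f x = y} * Nat.card H = Nat.card G := by
  obtain ⟨x₀, rfl⟩ := hf y
  have e : {x // f x = f x₀} ≃ f.ker :=
    { toFun := fun x => ⟨x.1 - x₀, by simp [AddMonoidHom.mem_ker, x.2]⟩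
      invFun := fun k => ⟨k.1 + x₀, by
        have := k.2
        rw [AddMonoidHom.mem_ker] at this
        simp [this]⟩
      left_inv := fun x => by simp
      right_inv := fun x => by simp }
  rw [Nat.card_congr e, ← Nat.card_congr (QuotientAddGroup.quotientKerEquivOfSurjective f hf).toEquiv,
    mul_comm]
  exact (AddSubgroup.card_eq_card_quotient_mul_card_addSubgroup f.ker).symm

lemma ker_count (Q : F[X] × F[X] × F[X]) (d e : ℕ) (hQ : Q ∈ Qset F d) (hp : Primitive Q)
    (hde : d ≤ e) : (Qset F e ∩ Ker Q).ncard * Fintype.card F ^ d = Fintype.card F ^ (2 * e) := by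
  let y : degreeLT F d := ⟨(-(Q.2.2 * X ^ e)) %ₘ Q.1, by
    rw [mem_degreeLT, ← hQ.2.1, ← degree_eq_natDegree hQ.1.ne_zero]
    exact degree_modByMonic_lt _ hQ.1⟩
  have hfib := fiber_card (phi Q d e hQ) (phi_surj Q d e hQ hp hde) y
  rw [Nat.card_prod, card_degreeLT, card_degreeLT] at hfib
  rw [two_mul, pow_add, ← hfib]
  congr 1
  have hdvd : ∀ x : degreeLT F e × degreeLT F e, phi Q d e hQ x = y ↔
      Q.1 ∣ Q.2.2 * (X ^ e + x.1.1) + Q.2.1 * x.2.1 := by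
    intro x
    rw [← Subtype.coe_inj]
    simp only [phi, AddMonoidHom.coe_mk, ZeroHom.coe_mk, y]
    rw [← sub_eq_zero, ← sub_modByMonic, modByMonic_eq_zero_iff_dvd hQ.1]
    rw [show Q.2.2 * (x.1.1 : F[X]) + Q.2.1 * x.2.1 - -(Q.2.2 * X ^ e) =
      Q.2.2 * (X ^ e + x.1.1) + Q.2.1 * x.2.1 by ring]
  have hset : Qset F e ∩ Ker Q = (fun x : degreeLT F e × degreeLT F e =>
      ((X ^ e + x.1.1, x.2.1, -((Q.2.2 * (X ^ e + x.1.1) + Q.2.1 * x.2.1) /ₘ Q.1)) :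
        F[X] × F[X] × F[X])) '' {x | phi Q d e hQ x = y} := by
    ext t
    constructor
    · rintro ⟨ht, hk⟩
      have hk' : Q.1 * t.2.2 + Q.2.1 * t.2.1 + Q.2.2 * t.1 = 0 := hk
      refine ⟨(((QsetEquiv e) ⟨t, ht⟩).1, ((QsetEquiv e) ⟨t, ht⟩).2.1), ?_, ?_⟩
      · change _ = _
        rw [hdvd]
        refine ⟨-t.2.2, ?_⟩
        simp only [QsetEquiv, Equiv.coe_fn_mk]
        linear_combination hk'
      · simp only [QsetEquiv, Equiv.coe_fn_mk, add_sub_cancel]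
        refine Prod.ext rfl (Prod.ext rfl ?_)
        simp only
        rw [show Q.2.2 * t.1 + Q.2.1 * t.2.1 = Q.1 * (-t.2.2) by linear_combination hk',
          mul_divByMonic_cancel_left _ hQ.1, neg_neg]
    · rintro ⟨x, hx, rfl⟩
      have hx' := (hdvd x).1 hx
      obtain ⟨m1, m2, m3, -⟩ := ((QsetEquiv e).symm (x.1, x.2, 0)).2
      simp only [QsetEquiv, Equiv.coe_fn_symm_mk] at m1 m2 m3
      obtain ⟨z, hz⟩ := hx'
      simp only [hz, mul_divByMonic_cancel_left _ hQ.1]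
      refine ⟨⟨m1, m2, m3, ?_⟩, ?_⟩
      · simp only [degree_neg]
        rw [← deg_aux hQ.1, ← hz]
        have hd1 : (X ^ e + x.1.1 : F[X]).degree = e := by
          rw [degree_eq_natDegree m1.ne_zero, m2]
        have hb : ∀ a b : F[X], a.degree < (d : WithBot ℕ) → b.degree ≤ (e : WithBot ℕ) →
            (a * b).degree < ((d + e : ℕ) : WithBot ℕ) := by
          intro a b ha hb
          by_cases h0 : a * b = 0
          · rw [h0, degree_zero]; exact WithBot.bot_lt_coe _
          · have ha0 := left_ne_zero_of_mul h0
            have hb0 := right_ne_zero_of_mul h0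
            rw [degree_eq_natDegree ha0] at ha
            rw [degree_eq_natDegree hb0] at hb
            rw [degree_eq_natDegree h0, natDegree_mul ha0 hb0]
            norm_cast at *
            omega
        rw [hQ.2.1]
        refine (degree_add_le _ _).trans_lt (max_lt ?_ ?_)
        · exact hb _ _ hQ.2.2.2 hd1.le
        · exact hb _ _ hQ.2.2.1 m3.le
      · change _ = _
        simp only
        linear_combination hz
  rw [hset, Set.InjOn.ncard_image, ← Nat.card_coe_set_eq]
  · rfl
  · rintro x - x' - h
    simp only [Prod.mk.injEq, add_right_inj] at h
    exact Prod.ext (Subtype.ext h.1) (Subtype.ext h.2.1)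

lemma primR_count (Q : F[X] × F[X] × F[X]) (d e : ℕ) (hQ : Q ∈ Qset F d) (hp : Primitive Q)
    (hde : d < e) : ((Qset F e ∩ Ker Q) ∩ {t | Primitive t}).ncard =
      (Fintype.card F - 1) * Fintype.card F ^ (2 * e - d - 1) := by
  obtain ⟨k, rfl⟩ : ∃ k, e = d + k + 1 := ⟨e - d - 1, by omega⟩
  have hq : 0 < Fintype.card F := Fintype.card_pos
  have h1 := ker_count Q d (d + k) hQ hp (by omega)
  have h2 := ker_count Q d (d + k + 1) hQ hp (by omega)
  have h3 := rec_count (Ker Q) (by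
    intro g hg t
    change _ = _ ↔ _ = _
    simp only [sm]
    rw [show Q.1 * (g * t.2.2) + Q.2.1 * (g * t.2.1) + Q.2.2 * (g * t.1) =
      g * (Q.1 * t.2.2 + Q.2.1 * t.2.1 + Q.2.2 * t.1) by ring]
    simp [hg]) (d + k)
  have hpos : 0 < Fintype.card F ^ d := pow_pos hq _
  have h1' : (Qset F (d + k) ∩ Ker Q).ncard = Fintype.card F ^ (d + 2 * k) := by
    apply Nat.eq_of_mul_eq_mul_right hpos
    rw [h1, ← pow_add]; congr 1; ring
  have h2' : (Qset F (d + k + 1) ∩ Ker Q).ncard = Fintype.card F ^ (d + 2 * k + 2) := by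
    apply Nat.eq_of_mul_eq_mul_right hpos
    rw [h2, ← pow_add]; congr 1; ring
  rw [h1', h2'] at h3
  rw [show 2 * (d + k + 1) - d - 1 = d + 2 * k + 1 by omega, Nat.sub_mul, one_mul]
  have h4 : Fintype.card F * Fintype.card F ^ (d + 2 * k) = Fintype.card F ^ (d + 2 * k + 1) :=
    (pow_succ' _ _).symm
  have h5 : Fintype.card F * Fintype.card F ^ (d + 2 * k + 1) = Fintype.card F ^ (d + 2 * k + 2) :=
    (pow_succ' _ _).symm
  rw [h4] at h3
  rw [h5, h3, Nat.add_sub_cancel]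

/-- Reversal of triples. -/
def rev (t : F[X] × F[X] × F[X]) : F[X] × F[X] × F[X] := (t.2.2, t.2.1, t.1)

lemma Rfib (Q : F[X] × F[X] × F[X]) (e : ℕ) :
    {R | R ∈ Rset F e ∧ Primitive R ∧ Intersecting Q R} =
      rev '' ((Qset F e ∩ Ker Q) ∩ {t | Primitive t}) := by
  ext R
  constructor
  · rintro ⟨⟨a1, a2, a3, a4⟩, h2, h3⟩
    exact ⟨rev R, ⟨⟨⟨a1, a2, a4, a3⟩, h3⟩, fun g x y z => h2 g z y x⟩, rfl⟩
  · rintro ⟨t, ⟨⟨⟨a1, a2, a3, a4⟩, h3⟩, h2⟩, rfl⟩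
    exact ⟨⟨a1, a2, a4, a3⟩, fun g x y z => h2 g z y x, h3⟩

lemma ncard_fibered {α β : Type*} (A : Set α) (hA : A.Finite) (B : α → Set β) (c : ℕ)
    (hB : ∀ a ∈ A, (B a).Finite) (hc : ∀ a ∈ A, (B a).ncard = c) :
    {p : α × β | p.1 ∈ A ∧ p.2 ∈ B p.1}.ncard = A.ncard * c := by
  have e : {p : α × β | p.1 ∈ A ∧ p.2 ∈ B p.1} ≃ Σ a : A, B a.1 :=
    { toFun := fun p => ⟨⟨p.1.1, p.2.1⟩, ⟨p.1.2, p.2.2⟩⟩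
      invFun := fun s => ⟨(s.1.1, s.2.1), s.1.2, s.2.2⟩
      left_inv := fun _ => rfl
      right_inv := fun _ => rfl }
  have := hA.fintype
  have h' : ∀ a : A, Finite (B a.1) := fun a => (hB a.1 a.2).to_subtype
  rw [← Nat.card_coe_set_eq, Nat.card_congr e, Nat.card_sigma]
  rw [Finset.sum_congr rfl (fun a _ => (Nat.card_coe_set_eq (B a.1)).trans (hc a.1 a.2))]
  rw [Finset.sum_const, Finset.card_univ, smul_eq_mul, ← Nat.card_eq_fintype_card,
    Nat.card_coe_set_eq]

end Flag

theorem stmt_0 (F : Type*) [Field F] [Fintype F] (q : ℕ) (hq : q = Fintype.card F)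
    (d₁ d₂ : ℕ) (h1 : 1 ≤ d₁) (h2 : d₁ < d₂) :
    Set.ncard {p : (F[X] × F[X] × F[X]) × (F[X] × F[X] × F[X]) |
        p.1 ∈ Qset F d₁ ∧ p.2 ∈ Rset F d₂ ∧ Primitive p.1 ∧ Primitive p.2 ∧
        Intersecting p.1 p.2} =
      (q - 1) ^ 2 * (q + 1) * q ^ (2 * d₁ + 2 * d₂ - 3) := by
  subst hq
  have hset : {p : (F[X] × F[X] × F[X]) × (F[X] × F[X] × F[X]) |
        p.1 ∈ Qset F d₁ ∧ p.2 ∈ Rset F d₂ ∧ Primitive p.1 ∧ Primitive p.2 ∧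
        Intersecting p.1 p.2} =
      {p | p.1 ∈ Qset F d₁ ∩ {t | Primitive t} ∧
        p.2 ∈ {R | R ∈ Rset F d₂ ∧ Primitive R ∧ Intersecting p.1 R}} := by
    ext p
    constructor
    · rintro ⟨a, b, c, d, e⟩
      exact ⟨⟨a, c⟩, b, d, e⟩
    · rintro ⟨⟨a, c⟩, b, d, e⟩
      exact ⟨a, b, c, d, e⟩
  have hrev : Function.Injective (Flag.rev (F := F)) := fun a b h => by
    simp only [Flag.rev, Prod.mk.injEq] at h
    exact Prod.ext h.2.2 (Prod.ext h.2.1 h.1)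
  rw [hset, Flag.ncard_fibered _ ((Flag.Qset_finite d₁).inter_of_left _) 
    (fun Q => {R | R ∈ Rset F d₂ ∧ Primitive R ∧ Intersecting Q R})
    ((Fintype.card F - 1) * Fintype.card F ^ (2 * d₂ - d₁ - 1))]
  · have h := Flag.primQ_count (F := F) d₁ h1
    have hq : 0 < Fintype.card F := Fintype.card_pos
    obtain ⟨a, rfl⟩ : ∃ a, d₁ = a + 1 := ⟨d₁ - 1, by omega⟩
    obtain ⟨b, rfl⟩ : ∃ b, d₂ = a + 1 + b + 1 := ⟨d₂ - a - 2, by omega⟩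
    obtain ⟨r, hr⟩ : ∃ r, Fintype.card F = r + 1 := ⟨Fintype.card F - 1, by omega⟩
    rw [hr] at h ⊢
    rw [show 3 * (a + 1) - 2 = 3 * a + 1 by omega] at h
    rw [show 2 * (a + 1 + b + 1) - (a + 1) - 1 = a + 2 * b + 2 by omega,
      show 2 * (a + 1) + 2 * (a + 1 + b + 1) - 3 = 4 * a + 2 * b + 3 by omega,
      Nat.add_sub_cancel]
    have h' : (Qset F (a + 1) ∩ {t | Primitive t}).ncard =
        (r + 1) ^ (3 * a + 1) * (r * (r + 2)) := by
      apply Nat.add_right_cancel (m := (r + 1) ^ (3 * a + 1))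
      rw [h]; ring
    rw [h']; ring
  · intro Q hQ
    rw [Flag.Rfib]
    exact (((Flag.Qset_finite d₂).inter_of_left _).inter_of_left _).image _
  · intro Q hQ
    rw [Flag.Rfib, Set.ncard_image_of_injective _ hrev]
    exact Flag.primR_count Q d₁ d₂ hQ.1 hQ.2 h2
end

section
/- Let r ≥ 1, let a₁, …, a_r be integers, let k ≥ 0 be an integer with k < aᵢ for all i, let d = a₁ + ⋯ + a_r, and let p = (p₁, …, p_r) ∈ 𝔽^r be a nonzero vector. Then the number of r-tuples (s₁, …, s_r) of polynomials in 𝔽[X] such that deg sᵢ ≤ aᵢ for all i, the coefficient of X^{aᵢ} in sᵢ equals pᵢ for all i, and the (monic) greatest common divisor of s₁, …, s_r has degree exactly k, equals q^{d−(r−1)k} − q^{d−(r−1)k−r+1}. -/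
open Polynomial

section helpers

variable {F : Type*} [Field F] [DecidableEq F]

/-- Based sections: degree bound and prescribed top coefficient. -/
def SS {r : ℕ} (p : Fin r → F) (a : Fin r → ℕ) : Set (Fin r → F[X]) :=
  {s | ∀ i, (s i).natDegree ≤ a i ∧ (s i).coeff (a i) = p i}

lemma gcd_unique {r : ℕ} (s t : Fin r → F[X]) (g : F[X]) (hg : g.Monic)
    (h : ∀ i, s i = g * t i) (ht : IsUnit (Finset.univ.gcd t)) : Finset.univ.gcd s = g := by
  have h1 : g ∣ Finset.univ.gcd s := Finset.dvd_gcd fun i _ => ⟨t i, h i⟩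
  have h2 : Finset.univ.gcd s ∣ g := by
    obtain ⟨e, he⟩ := h1
    have : e ∣ Finset.univ.gcd t := Finset.dvd_gcd fun i _ => by
      have := Finset.gcd_dvd (f := s) (Finset.mem_univ i)
      rw [he, h i] at this
      exact (mul_dvd_mul_iff_left hg.ne_zero).1 this
    have hu : IsUnit e := isUnit_of_dvd_unit this ht
    rw [he]
    exact (hu.mul_right_dvd).2 dvd_rfl
  have h3 := normalize_eq_normalize h2 h1
  rw [Finset.normalize_gcd] at h3
  rw [h3]
  exact hg.normalize_eq_self

lemma gcd_monic {r : ℕ} (s : Fin r → F[X]) (hs : s ≠ 0) : (Finset.univ.gcd s).Monic := by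
  have h0 : Finset.univ.gcd s ≠ 0 := by
    intro h
    rw [Finset.gcd_eq_zero_iff] at h
    exact hs (funext fun i => h i (Finset.mem_univ i))
  rw [← Finset.normalize_gcd]
  exact monic_normalize h0

lemma exists_factor {r : ℕ} (s : Fin r → F[X]) (hs : s ≠ 0) :
    ∃ (g : F[X]) (t : Fin r → F[X]), g.Monic ∧ s = (fun i => g * t i) ∧
      IsUnit (Finset.univ.gcd t) := by
  obtain ⟨j, hj⟩ : ∃ j, s j ≠ 0 := by
    by_contra! h
    exact hs (funext h)
  obtain ⟨t, h1, h2⟩ := Finset.extract_gcd (s := Finset.univ) s ⟨j, Finset.mem_univ j⟩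
  exact ⟨_, t, gcd_monic s hs, funext fun i => h1 i (Finset.mem_univ i), h2 ▸ isUnit_one⟩

lemma monic_step (g : F[X]) (hg : g.Monic) (c : F) :
    (X * g + C c).Monic ∧ (X * g + C c).natDegree = g.natDegree + 1 := by
  have h1 : (X * g).Monic := monic_X.mul hg
  have h2 : (X * g).natDegree = g.natDegree + 1 := by
    rw [monic_X.natDegree_mul hg, natDegree_X, add_comm]
  have h3 : (C c).degree < (X * g).degree := by
    rw [degree_eq_natDegree h1.ne_zero, h2]
    exact lt_of_le_of_lt degree_C_le (by exact_mod_cast Nat.succ_pos _)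
  exact ⟨h1.add_of_left h3, by rw [natDegree_add_C, h2]⟩

lemma divX_step (g : F[X]) (c : F) : (X * g + C c).divX = g := by
  ext n
  simp [coeff_divX, coeff_X_mul]

lemma step_iff (g t : F[X]) (hg : g.Monic) (c : F) (a : ℕ) (p : F) :
    ((g * t).natDegree ≤ a ∧ (g * t).coeff a = p) ↔
    (((X * g + C c) * t).natDegree ≤ a + 1 ∧ ((X * g + C c) * t).coeff (a + 1) = p) := by
  obtain ⟨h1, h2⟩ := monic_step g hg c
  by_cases ht : t = 0
  · simp [ht]
  rw [hg.natDegree_mul' ht, h1.natDegree_mul' ht, h2]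
  have e : g.natDegree + 1 + t.natDegree ≤ a + 1 ↔ g.natDegree + t.natDegree ≤ a := by omega
  rw [e]
  refine and_congr_right fun h => ?_
  have : t.coeff (a + 1) = 0 := coeff_eq_zero_of_natDegree_lt (by omega)
  rw [add_mul, mul_assoc, coeff_add, coeff_X_mul, coeff_C_mul, this]
  simp

lemma SS_ne_zero {r : ℕ} {p : Fin r → F} (hp : p ≠ 0) {a : Fin r → ℕ} {s : Fin r → F[X]}
    (hs : s ∈ SS p a) : s ≠ 0 := by
  rintro rfl
  exact hp (funext fun i => by simpa using (hs i).2.symm)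

/-- The step map. -/
noncomputable def phi {r : ℕ} (x : F × (Fin r → F[X])) : Fin r → F[X] :=
  fun i => (X * Finset.univ.gcd x.2 + C x.1) * (x.2 i / Finset.univ.gcd x.2)

noncomputable def psi {r : ℕ} (s : Fin r → F[X]) : F × (Fin r → F[X]) :=
  ((Finset.univ.gcd s).coeff 0, fun i => (Finset.univ.gcd s).divX * (s i / Finset.univ.gcd s))

lemma phi_eq {r : ℕ} (g : F[X]) (t : Fin r → F[X]) (c : F) (hg : g.Monic)
    (ht : IsUnit (Finset.univ.gcd t)) :
    phi (c, fun i => g * t i) = fun i => (X * g + C c) * t i := by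
  funext i
  simp only [phi]
  rw [gcd_unique (fun i => g * t i) t g hg (fun _ => rfl) ht,
    mul_div_cancel_left₀ _ hg.ne_zero]

lemma psi_eq {r : ℕ} (g : F[X]) (t : Fin r → F[X]) (c : F) (hg : g.Monic)
    (ht : IsUnit (Finset.univ.gcd t)) :
    psi (fun i => (X * g + C c) * t i) = (c, fun i => g * t i) := by
  have h1 := (monic_step g hg c).1
  simp only [psi]
  rw [gcd_unique (fun i => (X * g + C c) * t i) t _ h1 (fun _ => rfl) ht, divX_step]
  refine Prod.ext (by simp) (funext fun i => ?_)
  simp only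
  rw [mul_div_cancel_left₀ _ h1.ne_zero]

lemma exists_step (g : F[X]) (hg : g.Monic) (h : 1 ≤ g.natDegree) :
    ∃ g' c, g'.Monic ∧ g = X * g' + C c := by
  refine ⟨g.divX, g.coeff 0, ?_, (X_mul_divX_add g).symm⟩
  rw [Monic, leadingCoeff, natDegree_divX_eq_natDegree_tsub_one, coeff_divX,
    Nat.sub_add_cancel h]
  exact hg

lemma card_step [Fintype F] {r : ℕ} {p : Fin r → F} (hp : p ≠ 0) (a : Fin r → ℕ) (K : Set ℕ) :
    Set.ncard {s | s ∈ SS p (fun i => a i + 1) ∧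
      ∃ k ∈ K, (Finset.univ.gcd s).natDegree = k + 1} =
    Fintype.card F * Set.ncard {s | s ∈ SS p a ∧ (Finset.univ.gcd s).natDegree ∈ K} := by
  rw [← Nat.card_eq_fintype_card, ← Set.ncard_univ, ← Set.ncard_prod]
  symm
  have key : Set.BijOn (phi (F := F) (r := r))
      (Set.univ ×ˢ {s | s ∈ SS p a ∧ (Finset.univ.gcd s).natDegree ∈ K})
      {s | s ∈ SS p (fun i => a i + 1) ∧
        ∃ k ∈ K, (Finset.univ.gcd s).natDegree = k + 1} := by
    refine Set.InvOn.bijOn (f' := psi) ⟨?_, ?_⟩ ?_ ?_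
    · rintro ⟨c, s⟩ ⟨-, hs, hK⟩
      obtain ⟨g, t, hg, rfl, ht⟩ := exists_factor s (SS_ne_zero hp hs)
      rw [phi_eq g t c hg ht, psi_eq g t c hg ht]
    · rintro s ⟨hs, k, hk, hK⟩
      obtain ⟨g, t, hg, rfl, ht⟩ := exists_factor s (SS_ne_zero hp hs)
      rw [gcd_unique _ t g hg (fun _ => rfl) ht] at hK
      obtain ⟨g', c, hg', rfl⟩ := exists_step g hg (by omega)
      rw [psi_eq g' t c hg' ht, phi_eq g' t c hg' ht]
    · rintro ⟨c, s⟩ ⟨-, hs, hK⟩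
      simp only at hs hK
      obtain ⟨g, t, hg, rfl, ht⟩ := exists_factor s (SS_ne_zero hp hs)
      rw [phi_eq g t c hg ht]
      rw [gcd_unique _ t g hg (fun _ => rfl) ht] at hK
      refine ⟨fun i => (step_iff g (t i) hg c (a i) (p i)).1 (hs i), _, hK, ?_⟩
      rw [gcd_unique _ t _ (monic_step g hg c).1 (fun _ => rfl) ht, (monic_step g hg c).2]
    · rintro s ⟨hs, k, hk, hK⟩
      obtain ⟨g, t, hg, rfl, ht⟩ := exists_factor s (SS_ne_zero hp hs)
      rw [gcd_unique _ t g hg (fun _ => rfl) ht] at hK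
      obtain ⟨g', c, hg', rfl⟩ := exists_step g hg (by omega)
      rw [psi_eq g' t c hg' ht]
      refine ⟨Set.mem_univ _, fun i => (step_iff g' (t i) hg' c (a i) (p i)).2 (hs i), ?_⟩
      simp only
      rw [gcd_unique _ t g' hg' (fun _ => rfl) ht]
      rw [(monic_step g' hg' c).2] at hK
      rwa [Nat.succ_injective hK]
  rw [← key.image_eq, key.injOn.ncard_image]

noncomputable def oneEquiv (a : ℕ) (p : F) :
    {f : F[X] // f.natDegree ≤ a ∧ f.coeff a = p} ≃ degreeLT F a where
  toFun f := ⟨f.1 - C p * X ^ a, by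
    rw [mem_degreeLT, degree_lt_iff_coeff_zero]
    intro m hm
    rcases eq_or_lt_of_le hm with rfl | h
    · simp [f.2.2]
    · simp [coeff_X_pow, h.ne', coeff_eq_zero_of_natDegree_lt (lt_of_le_of_lt f.2.1 h)]⟩
  invFun f := ⟨f.1 + C p * X ^ a, by
    have h := mem_degreeLT.1 f.2
    refine ⟨?_, ?_⟩
    · refine natDegree_add_le_of_degree_le ?_ (natDegree_C_mul_X_pow_le _ _)
      exact natDegree_le_of_degree_le h.le
    · rw [degree_lt_iff_coeff_zero] at h
      simp [h a le_rfl]⟩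
  left_inv f := by simp
  right_inv f := by simp

def SSEquiv {r : ℕ} (p : Fin r → F) (a : Fin r → ℕ) :
    SS p a ≃ ∀ i, {f : F[X] // f.natDegree ≤ a i ∧ f.coeff (a i) = p i} where
  toFun s i := ⟨s.1 i, s.2 i⟩
  invFun s := ⟨fun i => (s i).1, fun i => (s i).2⟩
  left_inv _ := rfl
  right_inv _ := rfl

lemma SS_finite [Fintype F] {r : ℕ} (p : Fin r → F) (a : Fin r → ℕ) : (SS p a).Finite := by
  have : Finite (∀ i, {f : F[X] // f.natDegree ≤ a i ∧ f.coeff (a i) = p i}) := by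
    have h : ∀ i, Finite {f : F[X] // f.natDegree ≤ a i ∧ f.coeff (a i) = p i} := fun i =>
      Finite.of_equiv _ ((oneEquiv (a i) (p i)).trans (degreeLTEquiv F (a i)).toEquiv).symm
    infer_instance
  exact Set.finite_coe_iff.1 (Finite.of_equiv _ (SSEquiv p a).symm)

lemma SS_card [Fintype F] {r : ℕ} (p : Fin r → F) (a : Fin r → ℕ) :
    (SS p a).ncard = Fintype.card F ^ ∑ i, a i := by
  rw [← Nat.card_coe_set_eq, Nat.card_congr (SSEquiv p a), Nat.card_pi,
    ← Finset.prod_pow_eq_pow_sum]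
  refine Finset.prod_congr rfl fun i _ => ?_
  rw [Nat.card_congr ((oneEquiv (a i) (p i)).trans (degreeLTEquiv F (a i)).toEquiv)]
  simp

lemma card_zero [Fintype F] {r : ℕ} {p : Fin r → F} (hp : p ≠ 0) (b : Fin r → ℕ) :
    Set.ncard {s | s ∈ SS p (fun i => b i + 1) ∧ (Finset.univ.gcd s).natDegree = 0} =
      Fintype.card F ^ (∑ i, b i + r) - Fintype.card F ^ (∑ i, b i + 1) := by
  have h1 := card_step hp b Set.univ
  simp only [Set.mem_univ, and_true, true_and, Set.setOf_mem_eq, SS_card] at h1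
  have h2 := SS_card p (fun i => b i + 1)
  have h3 : SS p (fun i => b i + 1) =
      {s | s ∈ SS p (fun i => b i + 1) ∧ (Finset.univ.gcd s).natDegree = 0} ∪
      {s | s ∈ SS p (fun i => b i + 1) ∧ ∃ k, (Finset.univ.gcd s).natDegree = k + 1} := by
    ext s
    simp only [Set.mem_union, Set.mem_setOf_eq, ← and_or_left]
    refine (and_iff_left ?_).symm
    rcases h : (Finset.univ.gcd s).natDegree with _ | n
    · exact Or.inl rfl
    · exact Or.inr ⟨n, rfl⟩
  rw [h3, Set.ncard_union_eq ?_ ((SS_finite p _).subset fun _ h => h.1)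
    ((SS_finite p _).subset fun _ h => h.1), h1, Finset.sum_add_distrib] at h2
  · simp only [Finset.sum_const, Finset.card_univ, Fintype.card_fin, smul_eq_mul, mul_one] at h2
    rw [pow_succ', ← h2, Nat.add_sub_cancel]
  · rw [Set.disjoint_left]
    rintro s ⟨-, h⟩ ⟨-, k, h'⟩
    omega

lemma card_k [Fintype F] {r : ℕ} {p : Fin r → F} (hp : p ≠ 0) (b : Fin r → ℕ) (k : ℕ) :
    Set.ncard {s | s ∈ SS p (fun i => b i + 1 + k) ∧ (Finset.univ.gcd s).natDegree = k} =
      Fintype.card F ^ k *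
        (Fintype.card F ^ (∑ i, b i + r) - Fintype.card F ^ (∑ i, b i + 1)) := by
  induction k with
  | zero => simpa using card_zero hp b
  | succ k ih =>
    have h := card_step hp (fun i => b i + 1 + k) {k}
    simp only [Set.mem_singleton_iff, exists_eq_left] at h
    rw [ih] at h
    rw [pow_succ', mul_assoc, ← h]
    rfl

end helpers

theorem stmt_2 (F : Type*) [Field F] [Fintype F] [DecidableEq F] (q : ℕ) (hq : q = Fintype.card F)
    (r : ℕ) (hr : 1 ≤ r) (a : Fin r → ℕ) (k : ℕ) (hk : ∀ i, k < a i)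
    (d : ℕ) (hd : d = ∑ i, a i)
    (p : Fin r → F) (hp : p ≠ 0) :
    Set.ncard {s : Fin r → F[X] |
        (∀ i, (s i).degree ≤ ((a i : ℕ) : WithBot ℕ)) ∧
        (∀ i, (s i).coeff (a i) = p i) ∧
        (Finset.univ.gcd s).degree = (k : WithBot ℕ)} =
      q ^ (d - (r - 1) * k) - q ^ (d - (r - 1) * k - r + 1) := by
  obtain ⟨b, rfl⟩ : ∃ b : Fin r → ℕ, a = fun i => b i + 1 + k :=
    ⟨fun i => a i - 1 - k, funext fun i => by have := hk i; simp only; omega⟩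
  have h := card_k hp b k
  have hset : {s : Fin r → F[X] |
        (∀ i, (s i).degree ≤ ((b i + 1 + k : ℕ) : WithBot ℕ)) ∧
        (∀ i, (s i).coeff (b i + 1 + k) = p i) ∧
        (Finset.univ.gcd s).degree = (k : WithBot ℕ)} =
      {s | s ∈ SS p (fun i => b i + 1 + k) ∧ (Finset.univ.gcd s).natDegree = k} := by
    ext s
    have e : s ∈ SS p (fun i => b i + 1 + k) ↔
        (∀ i, (s i).degree ≤ ((b i + 1 + k : ℕ) : WithBot ℕ)) ∧
        (∀ i, (s i).coeff (b i + 1 + k) = p i) := by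
      simp only [SS, Set.mem_setOf_eq, forall_and, natDegree_le_iff_degree_le]
    simp only [Set.mem_setOf_eq]
    rw [← and_assoc, ← e]
    refine and_congr_right fun hs => ?_
    exact degree_eq_iff_natDegree_eq (gcd_monic s (SS_ne_zero hp hs)).ne_zero
  rw [hset, h, hq]
  obtain ⟨m, rfl⟩ : ∃ m, r = m + 1 := ⟨r - 1, by omega⟩
  have hd' : d = ∑ i, b i + (m + 1) + k + m * k := by
    rw [hd, Finset.sum_add_distrib, Finset.sum_add_distrib]
    simp
    ring
  have e1 : d - (m + 1 - 1) * k = k + (∑ i, b i + (m + 1)) := by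
    rw [hd', Nat.add_sub_cancel m 1, Nat.add_sub_cancel]; ring
  have e2 : k + (∑ i, b i + (m + 1)) - (m + 1) + 1 = k + (∑ i, b i + 1) := by omega
  rw [e1, e2, Nat.mul_sub, ← pow_add, ← pow_add]
end

section
/- For every integer d ≥ 1, the sum over all triples (q₀, q₁, q₂) ∈ 𝒬_d of q^{deg gcd(q₀, q₁, q₂)} equals q^{3d} + q^{3d−1} − q^{2d−1}. (Here gcd(q₀, q₁, q₂) is nonzero since q₀ is monic, so its degree is a well-defined nonnegative integer.) -/
open Polynomial

section Helpers

variable {F : Type*} [Field F]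

lemma ncard_degree_lt [Fintype F] (n : ℕ) :
    {p : F[X] | p.degree < (n : WithBot ℕ)}.ncard = Fintype.card F ^ n ∧
    {p : F[X] | p.degree < (n : WithBot ℕ)}.Finite := by
  have h : {p : F[X] | p.degree < (n : WithBot ℕ)} = (degreeLT F n : Set F[X]) := by
    ext p; simp [mem_degreeLT]
  have e : (degreeLT F n) ≃ (Fin n → F) := (degreeLTEquiv F n).toEquiv
  rw [h]
  constructor
  · rw [← Nat.card_coe_set_eq]
    have := Nat.card_congr e
    simpa using this
  · have : Finite (degreeLT F n) := Finite.of_equiv _ e.symm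
    exact Set.toFinite _

lemma monic_set_eq (n : ℕ) :
    {p : F[X] | p.Monic ∧ p.natDegree = n} =
      (fun p => X ^ n + p) '' {p : F[X] | p.degree < (n : WithBot ℕ)} := by
  ext p
  constructor
  · rintro ⟨hm, hn⟩
    refine ⟨p - X ^ n, ?_, by ring⟩
    have hd : p.degree = (n : WithBot ℕ) := by rw [degree_eq_natDegree hm.ne_zero, hn]
    have := degree_sub_lt (p := p) (q := X ^ n) (by rw [hd, degree_X_pow]) hm.ne_zero
      (by rw [hm.leadingCoeff, (monic_X_pow n).leadingCoeff])
    rwa [hd] at this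
  · rintro ⟨r, hr, rfl⟩
    have hr' : r.degree < (n : WithBot ℕ) := hr
    refine ⟨monic_X_pow_add hr', ?_⟩
    apply natDegree_eq_of_degree_eq_some
    rw [degree_add_eq_left_of_degree_lt (by rwa [degree_X_pow]), degree_X_pow]

lemma ncard_monic [Fintype F] (n : ℕ) :
    {p : F[X] | p.Monic ∧ p.natDegree = n}.ncard = Fintype.card F ^ n ∧
    {p : F[X] | p.Monic ∧ p.natDegree = n}.Finite := by
  rw [monic_set_eq]
  refine ⟨?_, (ncard_degree_lt n).2.image _⟩
  rw [Set.InjOn.ncard_image, (ncard_degree_lt n).1]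
  intro a _ b _ h
  exact add_left_cancel h

lemma Qset_eq (d : ℕ) : Qset F d = {p : F[X] | p.Monic ∧ p.natDegree = d} ×ˢ
    ({p : F[X] | p.degree < (d : WithBot ℕ)} ×ˢ {p : F[X] | p.degree < (d : WithBot ℕ)}) := by
  ext t
  simp [Qset, and_assoc]

lemma Qset_finite [Fintype F] (d : ℕ) : (Qset F d).Finite := by
  rw [Qset_eq]
  exact (ncard_monic d).2.prod ((ncard_degree_lt d).2.prod (ncard_degree_lt d).2)

lemma Qset_ncard [Fintype F] (d : ℕ) : (Qset F d).ncard = Fintype.card F ^ (3 * d) := by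
  rw [Qset_eq, Set.ncard_prod, Set.ncard_prod, (ncard_monic d).1, (ncard_degree_lt d).1]
  ring

variable [DecidableEq F]

/-- The gcd of a triple. -/
noncomputable def tgcd (t : F[X] × F[X] × F[X]) : F[X] := gcd t.1 (gcd t.2.1 t.2.2)

/-- Triples in `Qset F d` whose gcd has degree `k`. -/
def fib (F : Type*) [Field F] [DecidableEq F] (d k : ℕ) : Set (F[X] × F[X] × F[X]) :=
  {t | t ∈ Qset F d ∧ (tgcd t).natDegree = k}

/-- Scaling of a triple by a polynomial. -/
noncomputable def tmul (x : F[X] × (F[X] × F[X] × F[X])) : F[X] × F[X] × F[X] :=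
  (x.1 * x.2.1, x.1 * x.2.2.1, x.1 * x.2.2.2)

lemma tgcd_tmul (x : F[X] × (F[X] × F[X] × F[X])) :
    Associated (tgcd (tmul x)) (x.1 * tgcd x.2) := by
  unfold tgcd tmul
  exact ((Associated.refl _).gcd (gcd_mul_left' _ _ _)).trans (gcd_mul_left' _ _ _)

lemma natDegree_assoc {a b : F[X]} (h : Associated a b) : a.natDegree = b.natDegree :=
  natDegree_eq_of_degree_eq (degree_eq_degree_of_associated h)

lemma degree_mul_lt_iff' {g p : F[X]} (hg : g.Monic) {k d : ℕ} (hk : g.natDegree = k)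
    (hkd : k ≤ d) : (g * p).degree < (d : WithBot ℕ) ↔ p.degree < ((d - k : ℕ) : WithBot ℕ) := by
  by_cases hp : p = 0
  · simp [hp]
  · rw [← natDegree_lt_iff_degree_lt hp, ← natDegree_lt_iff_degree_lt (mul_ne_zero hg.ne_zero hp),
      natDegree_mul hg.ne_zero hp, hk]
    omega

lemma tmul_mem_iff {g : F[X]} (hg : g.Monic) {k d : ℕ} (hk : g.natDegree = k)
    (hkd : k ≤ d) (t : F[X] × F[X] × F[X]) : tmul (g, t) ∈ Qset F d ↔ t ∈ Qset F (d - k) := by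
  simp only [Qset, tmul, Set.mem_setOf_eq]
  rw [degree_mul_lt_iff' hg hk hkd, degree_mul_lt_iff' hg hk hkd]
  constructor
  · rintro ⟨h1, h2, h3⟩
    have hm := hg.of_mul_monic_left h1
    rw [hg.natDegree_mul hm] at h2
    exact ⟨hm, by omega, h3⟩
  · rintro ⟨h1, h2, h3⟩
    refine ⟨hg.mul h1, ?_, h3⟩
    rw [hg.natDegree_mul h1]
    omega

lemma tgcd_ne_zero {d : ℕ} {t : F[X] × F[X] × F[X]} (h : t ∈ Qset F d) : tgcd t ≠ 0 := by
  intro h0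
  have := (gcd_eq_zero_iff _ _).1 h0
  exact h.1.ne_zero this.1

lemma fib_eq {d k : ℕ} (hkd : k ≤ d) :
    fib F d k = tmul '' ({p : F[X] | p.Monic ∧ p.natDegree = k} ×ˢ fib F (d - k) 0) := by
  ext t
  constructor
  · rintro ⟨ht, hk⟩
    have h0 := tgcd_ne_zero ht
    have hm : (normalize (tgcd t)).Monic := monic_normalize h0
    have hass : Associated (normalize (tgcd t)) (tgcd t) := normalize_associated _
    have hn : (normalize (tgcd t)).natDegree = k := (natDegree_assoc hass).trans hk
    set g := normalize (tgcd t) with hg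
    have d1 : g ∣ t.1 := hass.dvd.trans (gcd_dvd_left _ _)
    have d2 : g ∣ t.2.1 := hass.dvd.trans ((gcd_dvd_right _ _).trans (gcd_dvd_left _ _))
    have d3 : g ∣ t.2.2 := hass.dvd.trans ((gcd_dvd_right _ _).trans (gcd_dvd_right _ _))
    obtain ⟨a, ha⟩ := d1
    obtain ⟨b, hb⟩ := d2
    obtain ⟨c, hc⟩ := d3
    have htt : tmul (g, (a, b, c)) = t := by
      ext1
      · exact ha.symm
      · ext1
        · exact hb.symm
        · exact hc.symm
    refine ⟨(g, (a, b, c)), ⟨⟨hm, hn⟩, ?_, ?_⟩, htt⟩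
    · exact (tmul_mem_iff hm hn hkd _).1 (htt ▸ ht)
    · have h1 := natDegree_assoc (tgcd_tmul (g, (a, b, c)))
      have h2 : tgcd (a, b, c) ≠ 0 :=
        tgcd_ne_zero ((tmul_mem_iff hm hn hkd (a, b, c)).1 (htt ▸ ht))
      rw [htt, hk, natDegree_mul hm.ne_zero h2, hn] at h1
      change (tgcd (a, b, c)).natDegree = 0
      omega
  · rintro ⟨⟨g, s⟩, ⟨⟨hm, hn⟩, hs, hs0⟩, rfl⟩
    refine ⟨(tmul_mem_iff hm hn hkd _).2 hs, ?_⟩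
    rw [natDegree_assoc (tgcd_tmul (g, s)), natDegree_mul hm.ne_zero (tgcd_ne_zero hs)]
    change g.natDegree + (tgcd s).natDegree = k
    change g.natDegree = k at hn
    change (tgcd s).natDegree = 0 at hs0
    omega

lemma tmul_assoc {d k : ℕ} {g : F[X]} {s : F[X] × F[X] × F[X]} (hs : s ∈ fib F d k)
    (h0 : k = 0) : Associated (tgcd (tmul (g, s))) g := by
  have hu : IsUnit (tgcd s) := by
    rw [isUnit_iff_degree_eq_zero, degree_eq_natDegree (tgcd_ne_zero hs.1), hs.2, h0]
    rfl
  exact (tgcd_tmul (g, s)).trans (associated_mul_unit_left _ _ hu)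

lemma fib_ncard [Fintype F] {d k : ℕ} (hkd : k ≤ d) :
    (fib F d k).ncard = Fintype.card F ^ k * (fib F (d - k) 0).ncard := by
  rw [fib_eq hkd, Set.InjOn.ncard_image, Set.ncard_prod, (ncard_monic k).1]
  rintro ⟨g, s⟩ ⟨⟨hm, hn⟩, hs⟩ ⟨g', s'⟩ ⟨⟨hm', hn'⟩, hs'⟩ h
  have hgg : g = g' := by
    apply eq_of_monic_of_associated hm hm'
    have h1 := tmul_assoc (g := g) hs rfl
    have h2 := tmul_assoc (g := g') hs' rfl
    simp only at h h1 h2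
    rw [h] at h1
    exact h1.symm.trans h2
  subst hgg
  obtain ⟨a, b, c⟩ := s
  obtain ⟨a', b', c'⟩ := s'
  simp only [tmul, Prod.mk.injEq] at h
  have hg0 : g ≠ 0 := Monic.ne_zero hm
  rw [mul_left_cancel₀ hg0 h.1, mul_left_cancel₀ hg0 h.2.1, mul_left_cancel₀ hg0 h.2.2]

lemma tgcd_natDegree_le {d : ℕ} {t : F[X] × F[X] × F[X]} (h : t ∈ Qset F d) :
    (tgcd t).natDegree ≤ d := by
  have := natDegree_le_of_dvd (gcd_dvd_left t.1 (gcd t.2.1 t.2.2)) h.1.ne_zero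
  rw [h.2.1] at this
  exact this

lemma sum_Qset [Fintype F] (d : ℕ) (f : ℕ → ℕ) :
    (∑ t ∈ (Qset_finite (F := F) d).toFinset, f (tgcd t).natDegree) =
      ∑ k ∈ Finset.range (d + 1), f k * (Fintype.card F ^ k * (fib F (d - k) 0).ncard) := by
  classical
  rw [← Finset.sum_fiberwise_of_maps_to (t := Finset.range (d + 1))
    (g := fun t => (tgcd t).natDegree)]
  · apply Finset.sum_congr rfl
    intro k hk
    rw [← fib_ncard (by simpa [Nat.lt_succ_iff] using hk)]
    rw [Finset.sum_congr rfl (g := fun _ => f k)]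
    · rw [Finset.sum_const, smul_eq_mul, mul_comm]
      congr 1
      rw [← Set.ncard_coe_finset]
      congr 1
      ext t
      simp [fib]
    · intro t ht
      rw [(Finset.mem_filter.1 ht).2]
  · intro t ht
    have := tgcd_natDegree_le ((Set.Finite.mem_toFinset _).1 ht)
    simp only [Finset.mem_range]
    omega

end Helpers

lemma arith_rec (q : ℕ) (A : ℕ → ℕ)
    (hT : ∀ d, ∑ k ∈ Finset.range (d + 1), q ^ k * A (d - k) = q ^ (3 * d)) (d : ℕ) :
    (∑ k ∈ Finset.range (d + 1 + 1), q ^ k * (q ^ k * A (d + 1 - k))) + q ^ (2 * d + 1) =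
      q ^ (3 * d + 3) + q ^ (3 * d + 2) := by
  have hA : ∀ d, A (d + 1) + q * q ^ (3 * d) = q ^ (3 * d + 3) := by
    intro d
    have h := hT (d + 1)
    rw [Finset.sum_range_succ'] at h
    rw [← hT d, Finset.mul_sum]
    simp only [Nat.add_sub_add_right, pow_zero, one_mul, Nat.sub_zero] at h
    rw [show 3 * d + 3 = 3 * (d + 1) by ring, ← h, add_comm]
    congr 1
    exact Finset.sum_congr rfl fun k _ => by ring
  have hS : ∀ d, ∑ k ∈ Finset.range (d + 1 + 1), q ^ k * (q ^ k * A (d + 1 - k)) =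
      q ^ 2 * (∑ k ∈ Finset.range (d + 1), q ^ k * (q ^ k * A (d - k))) + A (d + 1) := by
    intro d
    rw [Finset.sum_range_succ', Finset.mul_sum]
    simp only [Nat.add_sub_add_right, pow_zero, one_mul, Nat.sub_zero]
    congr 1
    exact Finset.sum_congr rfl fun k _ => by ring
  induction d with
  | zero =>
    have h0 := hT 0
    have h1 := hA 0
    rw [hS]
    simp at h0 h1 ⊢
    rw [h0]
    linarith
  | succ d ih =>
    have h1 := hA (d + 1)
    rw [hS]
    have e1 : q ^ (2 * (d + 1) + 1) = q ^ 2 * q ^ (2 * d + 1) := by ring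
    have e2 : q ^ (3 * (d + 1) + 2) = q ^ 2 * q ^ (3 * d + 3) := by ring
    have e3 : q * q ^ (3 * (d + 1)) = q ^ 2 * q ^ (3 * d + 2) := by ring
    rw [e1, e2, ← h1, e3]
    linear_combination q ^ 2 * ih

theorem stmt_5 (F : Type*) [Field F] [Fintype F] [DecidableEq F] (q : ℕ) (hq : q = Fintype.card F)
    (d : ℕ) (hd : 1 ≤ d) :
    (∑ᶠ t ∈ Qset F d, q ^ (gcd t.1 (gcd t.2.1 t.2.2)).natDegree) =
      q ^ (3 * d) + q ^ (3 * d - 1) - q ^ (2 * d - 1) := by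
  obtain ⟨n, rfl⟩ : ∃ n, d = n + 1 := ⟨d - 1, by omega⟩
  rw [finsum_mem_eq_finite_toFinset_sum _ (Qset_finite (n + 1))]
  have h := sum_Qset (F := F) (n + 1) (fun k => q ^ k)
  simp only [tgcd] at h
  rw [h]
  have hT : ∀ d, ∑ k ∈ Finset.range (d + 1), q ^ k * (fib F (d - k) 0).ncard = q ^ (3 * d) := by
    intro d
    have h1 := sum_Qset (F := F) d (fun _ => 1)
    simp only [one_mul, Finset.sum_const, smul_eq_mul, mul_one] at h1
    rw [← Set.ncard_eq_toFinset_card _ (Qset_finite d), Qset_ncard] at h1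
    rw [hq, h1]
  have := arith_rec q (fun m => (fib F m 0).ncard) hT n
  rw [← hq, show 3 * (n + 1) = 3 * n + 3 by ring, show 3 * n + 3 - 1 = 3 * n + 2 by omega,
    show 2 * (n + 1) - 1 = 2 * n + 1 by omega, ← this, Nat.add_sub_cancel]
end

section
/- Let d_b ≥ d_a ≥ 1 be integers and let Q = (q₀, q₁, q₂) ∈ 𝒬_{d_a} be primitive. Then the number of triples (ρ₀, ρ₁, ρ₂) of polynomials in 𝔽[X], each of degree < d_b, satisfying the homogeneous equation q₀ρ₀ + q₁ρ₁ + q₂ρ₂ = 0, equals q^{2d_b − d_a}. -/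
open Polynomial

theorem bezout_of_primitive {F : Type*} [Field F] (a b c : F[X])
    (h : Primitive (a, b, c)) : ∃ x y z : F[X], a * x + b * y + c * z = 1 := by
  classical
  have hu : IsUnit (EuclideanDomain.gcd a (EuclideanDomain.gcd b c)) := by
    have h3 := EuclideanDomain.gcd_dvd_right a (EuclideanDomain.gcd b c)
    exact h _ (EuclideanDomain.gcd_dvd_left _ _)
      (h3.trans (EuclideanDomain.gcd_dvd_left _ _))
      (h3.trans (EuclideanDomain.gcd_dvd_right _ _))
  obtain ⟨v, hv⟩ := hu.exists_right_inv
  have e1 := EuclideanDomain.gcd_eq_gcd_ab a (EuclideanDomain.gcd b c)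
  have e2 := EuclideanDomain.gcd_eq_gcd_ab b c
  rw [e1] at hv
  set A := EuclideanDomain.gcdA a (EuclideanDomain.gcd b c)
  set B := EuclideanDomain.gcdB a (EuclideanDomain.gcd b c)
  rw [e2] at hv
  refine ⟨A * v, EuclideanDomain.gcdA b c * B * v, EuclideanDomain.gcdB b c * B * v, ?_⟩
  rw [← hv]; ring

/-- The reduction map `(ρ₁, ρ₂) ↦ q₁ρ₁ + q₂ρ₂ mod q₀` on polynomials of degree `< n`. -/
noncomputable def redMap {F : Type*} [Field F] (a b c : F[X]) (n : ℕ) :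
    (degreeLT F n × degreeLT F n) →ₗ[F] F[X] :=
  (modByMonicHom a).comp
    (((LinearMap.mulLeft F b).comp (degreeLT F n).subtype).coprod
      ((LinearMap.mulLeft F c).comp (degreeLT F n).subtype))

theorem redMap_apply {F : Type*} [Field F] (a b c : F[X]) (n : ℕ)
    (p : degreeLT F n × degreeLT F n) :
    redMap a b c n p = (b * (p.1 : F[X]) + c * (p.2 : F[X])) %ₘ a := rfl

theorem range_redMap {F : Type*} [Field F] (a b c : F[X]) (m n : ℕ) (ha : a.Monic)
    (hm : a.degree = m) (hmn : m ≤ n) (h : Primitive (a, b, c)) :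
    LinearMap.range (redMap a b c n) = degreeLT F m := by
  apply le_antisymm
  · rintro _ ⟨p, rfl⟩
    rw [mem_degreeLT, redMap_apply, ← hm]
    exact degree_modByMonic_lt _ ha
  · intro t ht
    rw [mem_degreeLT, ← hm] at ht
    obtain ⟨x, y, z, hxyz⟩ := bezout_of_primitive a b c h
    have hlt : ∀ u : F[X], u %ₘ a ∈ degreeLT F n := fun u => by
      rw [mem_degreeLT]
      refine (degree_modByMonic_lt u ha).trans_le ?_
      rw [hm]; exact_mod_cast hmn
    refine ⟨(⟨(t * y) %ₘ a, hlt _⟩, ⟨(t * z) %ₘ a, hlt _⟩), ?_⟩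
    rw [redMap_apply]
    refine Eq.trans ?_ ((modByMonic_eq_self_iff ha).2 ht)
    apply modByMonic_eq_of_dvd_sub ha
    have e1 := modByMonic_add_div (t * y) a
    have e2 := modByMonic_add_div (t * z) a
    refine ⟨-(b * ((t * y) /ₘ a) + c * ((t * z) /ₘ a) + t * x), ?_⟩
    simp only
    linear_combination b * e1 + c * e2 + t * hxyz

theorem finrank_degLT (F : Type*) [Field F] (n : ℕ) : Module.finrank F (degreeLT F n) = n := by
  rw [(degreeLTEquiv F n).finrank_eq, Module.finrank_fin_fun]

theorem stmt_10 (F : Type*) [Field F] [Fintype F] (q : ℕ) (hq : q = Fintype.card F)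
    (da db : ℕ) (h1 : 1 ≤ da) (h2 : da ≤ db)
    (Q : F[X] × F[X] × F[X]) (hQ : Q ∈ Qset F da) (hQprim : Primitive Q) :
    Set.ncard {ρ : F[X] × F[X] × F[X] |
        ρ.1.degree < (db : WithBot ℕ) ∧ ρ.2.1.degree < (db : WithBot ℕ) ∧
        ρ.2.2.degree < (db : WithBot ℕ) ∧
        Q.1 * ρ.1 + Q.2.1 * ρ.2.1 + Q.2.2 * ρ.2.2 = 0} =
      q ^ (2 * db - da) := by
  obtain ⟨a, b, c⟩ := Q
  obtain ⟨ha, had, hb, hc⟩ := hQ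
  simp only at ha had hb hc ⊢
  have hdeg : a.degree = (da : WithBot ℕ) := by rw [degree_eq_natDegree ha.ne_zero, had]
  have : Module.Finite F (degreeLT F db) := Module.Finite.equiv (degreeLTEquiv F db).symm
  have hrn := LinearMap.finrank_range_add_finrank_ker (redMap a b c db)
  rw [range_redMap a b c da db ha hdeg h2 hQprim, Module.finrank_prod, finrank_degLT,
    finrank_degLT] at hrn
  have hcard := Module.natCard_eq_pow_finrank (K := F)
    (V := LinearMap.ker (redMap a b c db))
  rw [show Module.finrank F (LinearMap.ker (redMap a b c db)) = 2 * db - da by omega,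
    Nat.card_eq_fintype_card (α := F), ← hq] at hcard
  rw [← hcard, ← Nat.card_coe_set_eq]
  symm
  have hlt : ∀ (u r : F[X]), u.degree < (da : WithBot ℕ) → r.degree < (db : WithBot ℕ) →
      (u * r).degree < ((da + db : ℕ) : WithBot ℕ) := by
    intro u r hu hr
    by_cases hu0 : u = 0
    · simp [hu0, WithBot.bot_lt_coe]
    by_cases hr0 : r = 0
    · simp [hr0, WithBot.bot_lt_coe]
    rw [degree_eq_natDegree hu0] at hu
    rw [degree_eq_natDegree hr0] at hr
    rw [degree_mul, degree_eq_natDegree hu0, degree_eq_natDegree hr0]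
    norm_cast at hu hr ⊢
    omega
  refine Nat.card_congr
    { toFun := fun p => ⟨(-((b * (p.1.1 : F[X]) + c * (p.1.2 : F[X])) /ₘ a), p.1.1, p.1.2), ?_⟩
      invFun := fun ρ => ⟨(⟨ρ.1.2.1, mem_degreeLT.2 ρ.2.2.1⟩,
        ⟨ρ.1.2.2, mem_degreeLT.2 ρ.2.2.2.1⟩), ?_⟩
      left_inv := fun p => rfl
      right_inv := ?_ }
  · obtain ⟨⟨⟨r, hr⟩, ⟨s, hs⟩⟩, hp⟩ := p
    rw [LinearMap.mem_ker, redMap_apply] at hp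
    rw [mem_degreeLT] at hr hs
    simp only at hp ⊢
    have hdiv := modByMonic_add_div (b * r + c * s) a
    rw [hp, zero_add] at hdiv
    refine ⟨?_, hr, hs, by linear_combination -hdiv⟩
    have hsum : (b * r + c * s).degree < ((da + db : ℕ) : WithBot ℕ) :=
      (degree_add_le _ _).trans_lt (max_lt (hlt _ _ hb hr) (hlt _ _ hc hs))
    rw [← hdiv] at hsum
    rw [degree_neg]
    set w := (b * r + c * s) /ₘ a
    by_cases hw : w = 0
    · simp [hw, WithBot.bot_lt_coe]
    rw [degree_mul, hdeg, degree_eq_natDegree hw] at hsum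
    rw [degree_eq_natDegree hw]
    norm_cast at hsum ⊢
    omega
  · obtain ⟨⟨r0, r, s⟩, h0, hr, hs, he⟩ := ρ
    rw [LinearMap.mem_ker, redMap_apply, modByMonic_eq_zero_iff_dvd ha]
    simp only at he ⊢
    exact ⟨-r0, by linear_combination he⟩
  · rintro ⟨⟨r0, r, s⟩, h0, hr, hs, he⟩
    simp only at he
    have : b * r + c * s = a * (-r0) := by linear_combination he
    have h5 : (b * r + c * s) /ₘ a = -r0 := by rw [this, mul_divByMonic_cancel_left _ ha]
    simp [h5]
end
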